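/- Let A^{1,…,k} be a multipartition matrix such that for each ℓ ∈ {1,…,k−1}: (i) the pair (B_ℓ, A^{ℓ+1}) with B_ℓ = ∪_{n=1}^ℓ A^n satisfies the floret condition, so D_ℓ = B_ℓ ∩ A^{ℓ+1} is defined; (ii) there exist compressions Ã^{1,…,ℓ} of A^{1,…,ℓ} (containing x_u copies of the distinct column labeled u) and Ã^{ℓ+1} of A^{ℓ+1} (containing y_v copies of the v-th standard basis vector) such that the toric ideals I(Ã^{1,…,ℓ}) and I(Ã^{ℓ+1}) are homogeneous with respect to the multigrading in which the variable of each column has multidegree equal to the floret-indicator column of D_ℓ, the number of columns of A^{1,…,ℓ+1} with B_ℓ-row index u and A^{ℓ+1}-row index v equals x_u y_v whenever it is nonzero, and the kernel of the induced toric fiber product map ψ (sending z_{(u,v,s)} to x̄_{(u,s′)} ⊗ ȳ_{(v,s″)} with s = s′ y_v + s″) equals I(A^{1,…,ℓ+1}). Then A^{1,…,k} is well-connected and satisfies the GRIP. -/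

import Mathlib

open Finset

namespace PM

variable {k : ℕ} {J : Type*} {I : Type*} [Fintype J] [DecidableEq J] [DecidableEq I]

/- A partition matrix (a 0/1 matrix in which every column sums to 1), with columns
indexed by `J` and rows indexed by `I`, is encoded by the map sending each column to the
unique row having a 1 in that column.  A multipartition matrix with `k` blocks is a
family `S : Fin k → J → I` of such maps (block `b` is the partition matrix whose row
through column `j` is `S b j`). -/

/-- Columns `j` and `j'` agree in the first `ℓ` blocks (blocks of index `< ℓ`). -/
def colEquiv (S : Fin k → J → I) (ℓ : ℕ) (j j' : J) : Prop :=
  ∀ b : Fin k, (b : ℕ) < ℓ → S b j = S b j'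

instance {S : Fin k → J → I} {ℓ : ℕ} {j j' : J} : Decidable (colEquiv S ℓ j j') :=
  inferInstanceAs (Decidable (∀ b : Fin k, (b : ℕ) < ℓ → S b j = S b j'))

/-- The column weight `c^ℓ_j` of column `j` in the stacked matrix of the first `ℓ` blocks. -/
def colWeight (S : Fin k → J → I) (ℓ : ℕ) (j : J) : ℕ :=
  (univ.filter fun j' => colEquiv S ℓ j j').card

/-- Well-connectedness: for every block `b` and all columns `j`, `j'` in the support of one
row of block `b`, `c^{b+1}_j / c^{b}_j = c^{b+1}_{j'} / c^{b}_{j'}` (cross-multiplied;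
here `b+1` counts blocks, so `colWeight S ((b:ℕ)+1)` includes block `b`, and the
condition is trivially true for the first block). -/
def WellConnected (S : Fin k → J → I) : Prop :=
  ∀ (b : Fin k) (j j' : J), S b j = S b j' →
    colWeight S ((b : ℕ) + 1) j * colWeight S (b : ℕ) j' =
      colWeight S ((b : ℕ) + 1) j' * colWeight S (b : ℕ) j

/-- The set of rows of block `b` connected to the row of `B_b = ∪_{n<b} A^n` supported
on column `j` (a floret of block `b`, represented by the column `j`). -/
def stage (S : Fin k → J → I) (b : Fin k) (j : J) : Finset I :=
  (univ.filter fun j' => colEquiv S (b : ℕ) j j').image (S b)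

/-- The pair `(∪_{n<b} A^n, A^b)` satisfies the floret condition: the sets of rows of the
block `b` connected to two rows of `B_b` are equal or disjoint. -/
def FloretCondition (S : Fin k → J → I) (b : Fin k) : Prop :=
  ∀ j j' : J, stage S b j = stage S b j' ∨ Disjoint (stage S b j) (stage S b j')

/-- The `i`-th row of block `b`, as a real vector. -/
def rowVec (S : Fin k → J → I) (b : Fin k) (i : I) : J → ℝ :=
  fun j => if S b j = i then 1 else 0

/-- `α^b_i · d`, the dot product of the `i`-th row of block `b` with `d`. -/
def rowDot (S : Fin k → J → I) (b : Fin k) (i : I) (d : J → ℝ) : ℝ :=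
  ∑ j, (if S b j = i then d j else 0)

/-- The set of rows of the stacked matrix consisting of the first `ℓ` blocks. -/
def prefixRows (S : Fin k → J → I) (ℓ : ℕ) : Set (J → ℝ) :=
  {v | ∃ (b : Fin k) (i : I), (b : ℕ) < ℓ ∧ v = rowVec S b i}

/-- The row of `D = B_b ∩ A^b` through column `j0` (the indicator vector of the columns
whose floret pair is that of `j0`). -/
def dRow (S : Fin k → J → I) (b : Fin k) (j0 : J) : J → ℝ :=
  fun j => if stage S b j = stage S b j0 then 1 else 0

/-- The generalized running intersection property: for every block `b ≥ 1` (paper: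
`ℓ + 1` with `1 ≤ ℓ ≤ k-1`), (1) the stacked matrix of `B_b = ∪_{n<b}A^n` and `A^b` is
well-connected, (2) the pair `(B_b, A^b)` satisfies the floret condition, and (3) every
row of `B_b ∩ A^b` lies in the real row span of the first `b` blocks. -/
def GRIP (S : Fin k → J → I) : Prop :=
  ∀ b : Fin k, 0 < (b : ℕ) →
    (∀ j j' : J, S b j = S b j' →
      colWeight S ((b : ℕ) + 1) j * colWeight S (b : ℕ) j' =
        colWeight S ((b : ℕ) + 1) j' * colWeight S (b : ℕ) j) ∧
    FloretCondition S b ∧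
    (∀ j0 : J, dRow S b j0 ∈ Submodule.span ℝ (prefixRows S (b : ℕ)))

/-- The level-`b` floret `F^b[i]` containing the `i`-th row of block `b`. -/
def floret (S : Fin k → J → I) (b : Fin k) (i : I) : Finset I :=
  (univ.filter fun j => S b j = i).biUnion fun j => stage S b j

/-- `Σ_{i' ∈ F^b[i]} α^b_{i'} · d`. -/
def floretSum (S : Fin k → J → I) (b : Fin k) (i : I) (d : J → ℝ) : ℝ :=
  ∑ j, (if S b j ∈ floret S b i then d j else 0)

/-- The likelihood `∏_j p_j^{d_j}` of data `d` at the point `p`. -/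
noncomputable def likelihood (d p : J → ℝ) : ℝ := ∏ j, p j ^ d j

/-- The log-linear (partition) model determined by a set of rows: probability
vectors with positive entries whose coordinatewise logarithm lies in the row span. -/
def inModel (Rows : Set (J → ℝ)) (p : J → ℝ) : Prop :=
  (∀ j, 0 < p j) ∧ (∑ j, p j) = 1 ∧
    (fun j => Real.log (p j)) ∈ Submodule.span ℝ Rows

/-- `p` is a maximum likelihood estimate for the data `d` in the model determined by
`Rows`: it maximizes the likelihood over the closure of the model. -/
def IsMLE (Rows : Set (J → ℝ)) (d p : J → ℝ) : Prop :=
  p ∈ closure {q | inModel Rows q} ∧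
    ∀ q ∈ closure {q | inModel Rows q}, likelihood d q ≤ likelihood d p

/-- The iterative proportional scaling iterates: `ips S d 0` is the uniform
distribution, and step `ℓ+1` rescales by the `ℓ`-th block (`q^{ℓ+1}_j =
q^ℓ_j ⬝ (α^ℓ_{S(ℓ,j)} · d) / (α^ℓ_{S(ℓ,j)} · q^ℓ)`). -/
noncomputable def ips (S : Fin k → J → I) (d : J → ℝ) : ℕ → J → ℝ
  | 0 => fun _ => (Fintype.card J : ℝ)⁻¹
  | ℓ + 1 => fun j =>
      if h : ℓ < k then
        ips S d ℓ j * rowDot S ⟨ℓ, h⟩ (S ⟨ℓ, h⟩ j) d /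
          rowDot S ⟨ℓ, h⟩ (S ⟨ℓ, h⟩ j) (ips S d ℓ)
      else ips S d ℓ j

end PM

open Finset TensorProduct

/-- The toric ideal of an integer (here: natural-number) matrix `M` whose columns are
indexed by `J` and rows by `R`: the ideal of `ℂ[p_j : j ∈ J]` generated by all binomials
`p^u − p^v` with `u, v ∈ ℕ^J` and `M u = M v`. -/
noncomputable def toricIdeal {J : Type*} [Fintype J] {R : Type*} (M : J → R → ℕ) :
    Ideal (MvPolynomial J ℂ) :=
  Ideal.span {f | ∃ u v : J → ℕ,
    (∀ r : R, ∑ j, u j * M j r = ∑ j, v j * M j r) ∧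
    f = MvPolynomial.monomial (Finsupp.equivFunOnFinite.symm u) 1 -
        MvPolynomial.monomial (Finsupp.equivFunOnFinite.symm v) 1}

/-- The matrix of the first `ℓ` blocks of a multipartition matrix `S`, with rows indexed
by pairs (block, row index). -/
def stackMat {k m : ℕ} (S : Fin k → Fin m → ℕ) (ℓ : ℕ) : Fin m → (Fin k × ℕ) → ℕ :=
  fun j r => if (r.1 : ℕ) < ℓ ∧ S r.1 j = r.2 then 1 else 0

/-- The matrix of the compression `Ã^{1,…,ℓ}` of the first `b` blocks whose `t`-th column
is the column `ρ t`. -/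
def compPrefixMat {k m : ℕ} (S : Fin k → Fin m → ℕ) (b : Fin k) {nx : ℕ}
    (ρ : Fin nx → Fin m) : Fin nx → (Fin k × ℕ) → ℕ :=
  fun t r => if (r.1 : ℕ) < (b : ℕ) ∧ S r.1 (ρ t) = r.2 then 1 else 0

/-- The matrix of the compression `Ã^{ℓ+1}` of block `b` whose `t`-th column is the
standard basis vector of the row `S b (σ t)`. -/
def compBlockMat {k m : ℕ} (S : Fin k → Fin m → ℕ) (b : Fin k) {ny : ℕ}
    (σ : Fin ny → Fin m) : Fin ny → ℕ → ℕ :=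
  fun t i => if S b (σ t) = i then 1 else 0

/-- The toric fiber product map `ψ` sending `z_j  = z_{(u,v,s)}` to
`x̄_{(u,s′)} ⊗ ȳ_{(v,s″)}`, where `π` matches each column `j` of `A^{1,…,ℓ+1}` with a
pair of columns of the compressions. -/
noncomputable def tfpMap {k m : ℕ} (S : Fin k → Fin m → ℕ) (b : Fin k) {nx ny : ℕ}
    (ρ : Fin nx → Fin m) (σ : Fin ny → Fin m) (π : Fin m → Fin nx × Fin ny) :
    MvPolynomial (Fin m) ℂ →ₐ[ℂ]
      ((MvPolynomial (Fin nx) ℂ ⧸ toricIdeal (compPrefixMat S b ρ)) ⊗[ℂ]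
        (MvPolynomial (Fin ny) ℂ ⧸ toricIdeal (compBlockMat S b σ))) :=
  MvPolynomial.aeval fun j =>
    (Ideal.Quotient.mk (toricIdeal (compPrefixMat S b ρ)) (MvPolynomial.X (π j).1)) ⊗ₜ[ℂ]
      (Ideal.Quotient.mk (toricIdeal (compBlockMat S b σ)) (MvPolynomial.X (π j).2))


section helpers
open Finset PM

lemma colEquiv_congr {k m : ℕ} {S : Fin k → Fin m → ℕ} {ℓ : ℕ} {j j' : Fin m}
    (h : colEquiv S ℓ j j') (a : Fin m) : colEquiv S ℓ j a ↔ colEquiv S ℓ j' a :=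
  ⟨fun H b hb => (h b hb).symm.trans (H b hb), fun H b hb => (h b hb).trans (H b hb)⟩

lemma stage_congr {k m : ℕ} {S : Fin k → Fin m → ℕ} {b : Fin k} {j j' : Fin m}
    (h : colEquiv S (b : ℕ) j j') : stage S b j = stage S b j' := by
  unfold stage
  congr 1
  ext a
  simp [colEquiv_congr h a]

lemma colEquiv_succ {k m : ℕ} {S : Fin k → Fin m → ℕ} {b : Fin k} {j j' : Fin m} :
    colEquiv S ((b : ℕ) + 1) j j' ↔ colEquiv S (b : ℕ) j j' ∧ S b j = S b j' := by
  constructor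
  · intro h
    exact ⟨fun c hc => h c (by omega), h b (by omega)⟩
  · rintro ⟨h1, h2⟩ c hc
    by_cases hcb : (c : ℕ) < b
    · exact h1 c hcb
    · have : c = b := Fin.ext (by omega)
      rw [this]; exact h2

lemma colWeight_eq {k m : ℕ} {S : Fin k → Fin m → ℕ} {b : Fin k}
    {x : Fin m → ℕ} {y : ℕ → ℕ}
    (hx : ∀ j j' : Fin m, colEquiv S (b : ℕ) j j' → x j = x j')
    (hw : ∀ j : Fin m, colWeight S ((b : ℕ) + 1) j = x j * y (S b j)) (j : Fin m) :
    colWeight S (b : ℕ) j = x j * ∑ v ∈ stage S b j, y v := by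
  unfold colWeight
  rw [Finset.card_eq_sum_card_image (S b), Finset.mul_sum]
  refine Finset.sum_congr rfl ?_
  intro v hv
  obtain ⟨a, ha, rfl⟩ := Finset.mem_image.1 hv
  have ha' : colEquiv S (b : ℕ) j a := by simpa using ha
  rw [hx j a ha', ← hw a]
  unfold colWeight
  congr 1
  ext c
  simp only [mem_filter, mem_univ, true_and, colEquiv_succ, colEquiv_congr ha' c]
  exact and_congr_right fun _ => eq_comm

lemma wc_aux {k m : ℕ} {S : Fin k → Fin m → ℕ} {b : Fin k} (hf : FloretCondition S b)
    {x : Fin m → ℕ} {y : ℕ → ℕ}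
    (hx : ∀ j j' : Fin m, colEquiv S (b : ℕ) j j' → x j = x j')
    (hw : ∀ j : Fin m, colWeight S ((b : ℕ) + 1) j = x j * y (S b j)) (j j' : Fin m)
    (hj : S b j = S b j') :
    colWeight S ((b : ℕ) + 1) j * colWeight S (b : ℕ) j' =
      colWeight S ((b : ℕ) + 1) j' * colWeight S (b : ℕ) j := by
  have mem : ∀ a, S b a ∈ stage S b a := fun a =>
    Finset.mem_image.2 ⟨a, by simp [colEquiv], rfl⟩
  have hs : stage S b j = stage S b j' := by
    rcases hf j j' with h | h
    · exact h
    · exact absurd (hj ▸ mem j') (Finset.disjoint_left.1 h (mem j))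
  rw [colWeight_eq hx hw, colWeight_eq hx hw, hw, hw, hs, hj]
  ring

/-- If every integer vector killed by the rows is killed by `d`, then `d` is in the span. -/
lemma mem_span_of_int {m : ℕ} (Rows : Set (Fin m → ℚ)) (d : Fin m → ℚ)
    (H : ∀ z : Fin m → ℤ, (∀ r ∈ Rows, ∑ j, (z j : ℚ) * r j = 0) → ∑ j, (z j : ℚ) * d j = 0) :
    d ∈ Submodule.span ℚ Rows := by
  by_contra hd
  obtain ⟨f, hf, hle⟩ := Submodule.exists_le_ker_of_notMem hd
  obtain ⟨N, hN⟩ := IsLocalization.exist_integer_multiples_of_finite (nonZeroDivisors ℤ)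
    (fun j : Fin m => f (Pi.single j 1))
  choose z hz using hN
  have hN0 : ((N : ℤ) : ℚ) ≠ 0 := by
    exact_mod_cast nonZeroDivisors.ne_zero N.2
  have key : ∀ r : Fin m → ℚ, ∑ j, (z j : ℚ) * r j = ((N : ℤ) : ℚ) * f r := by
    intro r
    rw [LinearMap.pi_apply_eq_sum_univ f r, Finset.mul_sum]
    refine Finset.sum_congr rfl fun j _ => ?_
    have h1 : (z j : ℚ) = ((N : ℤ) : ℚ) * f (Pi.single j 1) := by
      have := hz j
      simpa using this
    have h2 : (fun i => if j = i then (1 : ℚ) else 0) = Pi.single j 1 := by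
      ext i
      simp [Pi.single_apply, eq_comm]
    rw [h1, h2, smul_eq_mul]
    ring
  have h0 := H z fun r hr => by
    have : f r = 0 := hle (Submodule.subset_span hr)
    rw [key, this, mul_zero]
  rw [key] at h0
  exact hf ((mul_eq_zero.1 h0).resolve_left hN0)

lemma span_aux {k m : ℕ} {S : Fin k → Fin m → ℕ} {b : Fin k} {nx : ℕ} (ρ : Fin nx → Fin m)
    (τ : Fin m → Fin nx) (hτ : ∀ j, colEquiv S (b : ℕ) (ρ (τ j)) j)
    (hh : ∀ u v : Fin nx → ℕ,
          (∀ (b' : Fin k) (i : ℕ), (b' : ℕ) < (b : ℕ) →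
            ∑ t, u t * (if S b' (ρ t) = i then 1 else 0) =
              ∑ t, v t * (if S b' (ρ t) = i then 1 else 0)) →
          ∀ j0 : Fin m,
            ∑ t, u t * (if stage S b (ρ t) = stage S b j0 then 1 else 0) =
              ∑ t, v t * (if stage S b (ρ t) = stage S b j0 then 1 else 0))
    (j0 : Fin m) : dRow S b j0 ∈ Submodule.span ℝ (prefixRows S (b : ℕ)) := by
  have hq : (fun j => if stage S b j = stage S b j0 then (1 : ℚ) else 0) ∈
      Submodule.span ℚ {v : Fin m → ℚ | ∃ (b' : Fin k) (i : ℕ), (b' : ℕ) < b ∧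
        v = fun j => if S b' j = i then (1 : ℚ) else 0} := by
    apply mem_span_of_int
    intro z hz
    -- pushing forward a vector along `τ`
    have push : ∀ (w : Fin m → ℕ) (g : Fin nx → ℕ),
        ∑ t, (∑ j with τ j = t, w j) * g t = ∑ j, w j * g (τ j) := by
      intro w g
      rw [← Finset.sum_fiberwise (s := univ) (g := τ)]
      refine Finset.sum_congr rfl fun t _ => ?_
      rw [Finset.sum_mul]
      refine Finset.sum_congr rfl fun j hj => ?_
      rw [(Finset.mem_filter.1 hj).2]
    have split : ∀ g : Fin m → ℕ, ∑ j, (z j : ℚ) * (g j : ℚ) = 0 ↔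
        ∑ j, (z j).toNat * g j = ∑ j, (-z j).toNat * g j := by
      intro g
      have hzz : ∀ j, (z j : ℚ) = ((z j).toNat : ℚ) - ((-z j).toNat : ℚ) := by
        intro j
        exact_mod_cast (Int.toNat_sub_toNat_neg (z j)).symm
      have e : ∑ j, (z j : ℚ) * (g j : ℚ) = ((∑ j, (z j).toNat * g j : ℕ) : ℚ) -
          ((∑ j, (-z j).toNat * g j : ℕ) : ℚ) := by
        push_cast
        rw [← Finset.sum_sub_distrib]
        exact Finset.sum_congr rfl fun j _ => by rw [← sub_mul, ← hzz j]
      rw [e, sub_eq_zero, Nat.cast_inj]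
    have main := hh (fun t => ∑ j with τ j = t, (z j).toNat)
      (fun t => ∑ j with τ j = t, (-z j).toNat) ?_ j0
    · rw [push _ fun t => if stage S b (ρ t) = stage S b j0 then 1 else 0,
        push _ fun t => if stage S b (ρ t) = stage S b j0 then 1 else 0] at main
      simp only [stage_congr (hτ _)] at main
      have := (split _).2 main
      simpa using this
    · intro b' i hb'
      rw [push _ fun t => if S b' (ρ t) = i then 1 else 0,
        push _ fun t => if S b' (ρ t) = i then 1 else 0]
      simp only [hτ _ b' hb']
      apply (split _).1
      have := hz _ ⟨b', i, hb', rfl⟩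
      simpa using this
  have cast_mem : ∀ v ∈ Submodule.span ℚ {v : Fin m → ℚ | ∃ (b' : Fin k) (i : ℕ),
        (b' : ℕ) < b ∧ v = fun j => if S b' j = i then (1 : ℚ) else 0},
      (fun j => ((v j : ℚ) : ℝ)) ∈ Submodule.span ℝ (prefixRows S (b : ℕ)) := by
    intro v hv
    induction hv using Submodule.span_induction with
    | mem v hv =>
      obtain ⟨b', i, hb', rfl⟩ := hv
      refine Submodule.subset_span ⟨b', i, hb', ?_⟩
      ext j
      by_cases hc : S b' j = i <;> simp [rowVec, hc]
    | zero =>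
      convert Submodule.zero_mem _ using 1
      ext j
      simp
    | add v w _ _ h1 h2 =>
      convert Submodule.add_mem _ h1 h2 using 1
      ext j
      simp
    | smul a v _ h1 =>
      convert Submodule.smul_mem _ (a : ℝ) h1 using 1
      ext j
      simp
  convert cast_mem _ hq using 1
  ext j
  by_cases hc : stage S b j = stage S b j0 <;> simp [dRow, hc]

end helpers

open Finset PM in
/-- Proposition 3.15.  Let `A^{1,…,k}` (encoded by `S`) be a
multipartition matrix such that for each block `b` with `1 ≤ b ≤ k−1`: (i) the pair
`(B_b, A^{b+1})` (with `B_b = ∪_{n≤b} A^n`) satisfies the floret condition, so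
`D_b = B_b ∩ A^{b+1}` is defined; (ii) there exist compressions `Ã^{1,…,b}` (containing
exactly `x_u` copies of the distinct column labeled `u`) and `Ã^{b+1}` (containing
exactly `y_v` copies of the `v`-th standard basis vector) such that the toric ideals
`I(Ã^{1,…,b})` and `I(Ã^{b+1})` are homogeneous with respect to the multigrading in
which the variable of each column has multidegree the floret-indicator column of `D_b`
(stated combinatorially: exponent vectors with equal image under the compression matrix
have equal image under the compressed `D_b`), the number of columns of `A^{1,…,b+1}`
with `B_b`-row `u` and `A^{b+1}`-row `v` equals `x_u y_v` whenever it is nonzero, and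
the kernel of the induced toric fiber product map `ψ` equals `I(A^{1,…,b+1})`.  Then
`A^{1,…,k}` is well-connected and satisfies the GRIP. -/
theorem tfp_implies_grip {k m : ℕ} (S : Fin k → Fin m → ℕ)
    (h : ∀ b : Fin k, 0 < (b : ℕ) →
      FloretCondition S b ∧
      ∃ (nx ny : ℕ) (ρ : Fin nx → Fin m) (σ : Fin ny → Fin m)
        (x : Fin m → ℕ) (y : ℕ → ℕ) (π : Fin m → Fin nx × Fin ny),
        (∀ j j' : Fin m, colEquiv S (b : ℕ) j j' → x j = x j') ∧
        (∀ j, 0 < x j) ∧ (∀ j, 0 < y (S b j)) ∧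
        (∀ j : Fin m, (univ.filter fun t => colEquiv S (b : ℕ) (ρ t) j).card = x j) ∧
        (∀ j : Fin m, (univ.filter fun t => S b (σ t) = S b j).card = y (S b j)) ∧
        (∀ j : Fin m, colWeight S ((b : ℕ) + 1) j = x j * y (S b j)) ∧
        (∀ u v : Fin nx → ℕ,
          (∀ (b' : Fin k) (i : ℕ), (b' : ℕ) < (b : ℕ) →
            ∑ t, u t * (if S b' (ρ t) = i then 1 else 0) =
              ∑ t, v t * (if S b' (ρ t) = i then 1 else 0)) →
          ∀ j0 : Fin m,
            ∑ t, u t * (if stage S b (ρ t) = stage S b j0 then 1 else 0) =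
              ∑ t, v t * (if stage S b (ρ t) = stage S b j0 then 1 else 0)) ∧
        (∀ u v : Fin ny → ℕ,
          (∀ i : ℕ,
            ∑ t, u t * (if S b (σ t) = i then 1 else 0) =
              ∑ t, v t * (if S b (σ t) = i then 1 else 0)) →
          ∀ j0 : Fin m,
            ∑ t, u t * (if stage S b (σ t) = stage S b j0 then 1 else 0) =
              ∑ t, v t * (if stage S b (σ t) = stage S b j0 then 1 else 0)) ∧
        (∀ j, colEquiv S (b : ℕ) (ρ (π j).1) j) ∧
        (∀ j, S b (σ (π j).2) = S b j) ∧
        Function.Injective π ∧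
        toricIdeal (stackMat S ((b : ℕ) + 1)) =
          RingHom.ker (tfpMap S b ρ σ π).toRingHom) :
    WellConnected S ∧ GRIP S := by
  have hwc : ∀ b : Fin k, 0 < (b : ℕ) → ∀ j j' : Fin m, S b j = S b j' →
      colWeight S ((b : ℕ) + 1) j * colWeight S (b : ℕ) j' =
        colWeight S ((b : ℕ) + 1) j' * colWeight S (b : ℕ) j := by
    intro b hb
    obtain ⟨hf, nx, ny, ρ, σ, x, y, π, hx, -, -, -, -, hw, -⟩ := h b hb
    exact wc_aux hf hx hw
  refine ⟨?_, ?_⟩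
  · intro b j j' hj
    by_cases hb : 0 < (b : ℕ)
    · exact hwc b hb j j' hj
    · have e : colEquiv S ((b : ℕ) + 1) j j' :=
        colEquiv_succ.2 ⟨fun c hc => absurd hc (by omega), hj⟩
      have e' : colEquiv S (b : ℕ) j j' := (colEquiv_succ.1 e).1
      have h1 : colWeight S ((b : ℕ) + 1) j = colWeight S ((b : ℕ) + 1) j' := by
        unfold colWeight; simp only [colEquiv_congr e]
      have h2 : colWeight S (b : ℕ) j = colWeight S (b : ℕ) j' := by
        unfold colWeight; simp only [colEquiv_congr e']
      rw [h1, h2]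
  · intro b hb
    refine ⟨hwc b hb, (h b hb).1, ?_⟩
    obtain ⟨hf, nx, ny, ρ, σ, x, y, π, -, -, -, -, -, -, hh, -, hπ, -⟩ := h b hb
    exact span_aux ρ (fun j => (π j).1) hπ hh
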